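/- arXiv:1707.08453 — 3 statements merged into one kernel-verified Lean document; each statement's English description precedes it below -/
import Mathlib

section
/- Assume the Case (B) setup with v3 = 0, v1 > 0, v2 > 0 and gcd(n1,n2,n3,n4) = 1, and assume moreover that a2 < a1, a3 < u1 + u2, v2 < a2 and a1 + v1 = a2 − v2 + a4. Let b = (a2·a3, a1·a3, a1·u2 + u1·a2, a2·a3). Then for every integer w ≥ 0 such that the four entries of n + w·b have greatest common divisor 1, the ideal I(n + w·b)_* equals the ideal of K[x1,x2,x3,x4] generated by x2^{a2}, x3^{a3}, x1^{v1+w}x2^{v2} and x1^{a1+v1+w} − x2^{a2−v2}x4^{a4+w}, and this ideal cannot be generated by fewer than 4 polynomials (i.e. it is an almost complete intersection). -/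
open MvPolynomial

/-- The toric ideal of the monomial curve `(t^{n 0}, t^{n 1}, t^{n 2}, t^{n 3})`:
the kernel of the `K`-algebra map `K[x₁,x₂,x₃,x₄] → K[t]`, `xᵢ ↦ t^{n i}`. -/
noncomputable def toricIdeal (K : Type*) [Field K] (n : Fin 4 → ℕ) :
    Ideal (MvPolynomial (Fin 4) K) :=
  RingHom.ker (aeval (fun i => (Polynomial.X : Polynomial K) ^ n i) :
    MvPolynomial (Fin 4) K →ₐ[K] Polynomial K)

/-- The ideal `I_*` generated by the least-degree nonzero homogeneous components `f_*`
of the nonzero elements `f ∈ I`. -/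
noncomputable def idealStar {K : Type*} [Field K] (I : Ideal (MvPolynomial (Fin 4) K)) :
    Ideal (MvPolynomial (Fin 4) K) :=
  Ideal.span {g | ∃ f ∈ I, f ≠ 0 ∧ ∃ d : ℕ,
    (∀ e < d, homogeneousComponent e f = 0) ∧
    homogeneousComponent d f ≠ 0 ∧ g = homogeneousComponent d f}


/-- If the weight is injective on `S`, and modulo `J` every monomial either reduces to a monomial
of `S` with the same weight and degree, or vanishes while `S` has a monomial of the same weight and
larger degree, then `J` contains `I_*`. -/
theorem idealStar_toricIdeal_le {K : Type*} [Field K] (n : Fin 4 → ℕ)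
    (J : Ideal (MvPolynomial (Fin 4) K)) (S : Set (Fin 4 →₀ ℕ))
    (hS : Set.InjOn (Finsupp.weight n) S)
    (hred : ∀ m : Fin 4 →₀ ℕ, ∃ s ∈ S, Finsupp.weight n s = Finsupp.weight n m ∧
      (m.degree < s.degree ∧ monomial m (1 : K) ∈ J ∨
        m.degree = s.degree ∧ monomial m (1 : K) - monomial s 1 ∈ J)) :
    idealStar (toricIdeal K n) ≤ J := by
  classical
  refine Ideal.span_le.2 ?_
  rintro g ⟨f, hf, -, d, hlow, -, rfl⟩
  let θ : Polynomial K →ₗ[K] MvPolynomial (Fin 4) K :=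
    (Polynomial.basisMonomials K).constr K fun W =>
      if h : ∃ s ∈ S, Finsupp.weight n s = W ∧ s.degree = d then monomial h.choose 1 else 0
  have hθ (W : ℕ) : θ (Polynomial.monomial W 1) =
      if h : ∃ s ∈ S, Finsupp.weight n s = W ∧ s.degree = d then monomial h.choose 1 else 0 := by
    have := (Polynomial.basisMonomials K).constr_basis K (fun W =>
      if h : ∃ s ∈ S, Finsupp.weight n s = W ∧ s.degree = d then
        (monomial h.choose 1 : MvPolynomial (Fin 4) K) else 0) W
    rwa [Polynomial.coe_basisMonomials] at this
  have hmon (m : Fin 4 →₀ ℕ) (c : K) :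
      aeval (fun i => (Polynomial.X : Polynomial K) ^ n i) (monomial m c) =
        c • Polynomial.monomial (Finsupp.weight n m) 1 := by
    rw [aeval_monomial, Finsupp.weight_apply, ← Polynomial.X_pow_eq_monomial, Algebra.smul_def]
    congr 1
    simp [Finsupp.prod, Finsupp.sum, ← pow_mul, Finset.prod_pow_eq_pow_sum, mul_comm]
  have hkey (m : Fin 4 →₀ ℕ) (c : K) (hm : d ≤ m.degree) :
      homogeneousComponent d (monomial m c) -
        θ (aeval (fun i => (Polynomial.X : Polynomial K) ^ n i) (monomial m c)) ∈ J := by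
    obtain ⟨s, hs, hw, h⟩ := hred m
    rw [hmon, map_smul, hθ, homogeneousComponent_of_mem (isHomogeneous_monomial c rfl)]
    have huniq {t} (ht : t ∈ S) (htw : Finsupp.weight n t = Finsupp.weight n m) : t = s :=
      hS ht hs (htw.trans hw.symm)
    have hc : monomial m c = C c * monomial m (1 : K) := by simp [C_mul_monomial]
    rcases h with ⟨hlt, hJ⟩ | ⟨hdeg, hJ⟩
    · rw [dif_neg]
      · rw [smul_zero, sub_zero]
        split_ifs
        · rw [hc]; exact J.mul_mem_left _ hJ
        · exact J.zero_mem
      · rintro ⟨t, ht, htw, htd⟩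
        obtain rfl := huniq ht htw
        omega
    · by_cases hd : d = m.degree
      · have hex : ∃ s ∈ S, Finsupp.weight n s = Finsupp.weight n m ∧ s.degree = d :=
          ⟨s, hs, hw, by omega⟩
        rw [if_pos hd, dif_pos hex, huniq hex.choose_spec.1 hex.choose_spec.2.1, hc,
          smul_eq_C_mul, ← mul_sub]
        exact J.mul_mem_left _ hJ
      · rw [if_neg hd, dif_neg]
        · simp
        · rintro ⟨t, ht, htw, htd⟩
          obtain rfl := huniq ht htw
          omega
  have hsum : homogeneousComponent d f -
      θ (aeval (fun i => (Polynomial.X : Polynomial K) ^ n i) f) ∈ J := by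
    conv =>
      enter [2]
      rw [f.as_sum]
    simp only [map_sum, ← Finset.sum_sub_distrib]
    refine J.sum_mem fun m hm => hkey m _ ?_
    by_contra! hlt
    have := congrArg (coeff m) (hlow _ hlt)
    rw [coeff_homogeneousComponent, if_pos rfl, coeff_zero] at this
    exact mem_support_iff.1 hm this
  rwa [RingHom.mem_ker.1 hf, map_zero, sub_zero] at hsum

theorem monomial_sub_monomial_mem_toricIdeal {K : Type*} [Field K] {n : Fin 4 → ℕ}
    {p q : Fin 4 →₀ ℕ} (h : Finsupp.weight n p = Finsupp.weight n q) :
    monomial p (1 : K) - monomial q 1 ∈ toricIdeal K n := by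
  have hmon (m : Fin 4 →₀ ℕ) :
      aeval (fun i => (Polynomial.X : Polynomial K) ^ n i) (monomial m (1 : K)) =
        Polynomial.X ^ Finsupp.weight n m := by
    rw [aeval_monomial, Finsupp.weight_apply]
    simp [Finsupp.prod, Finsupp.sum, ← pow_mul, Finset.prod_pow_eq_pow_sum, mul_comm]
  rw [toricIdeal, RingHom.mem_ker, map_sub]
  exact sub_eq_zero.2 ((hmon p).trans (h ▸ (hmon q).symm))

theorem monomial_mem_idealStar {K : Type*} [Field K] {n : Fin 4 → ℕ} {p q : Fin 4 →₀ ℕ}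
    (h : Finsupp.weight n p = Finsupp.weight n q) (hd : p.degree < q.degree) :
    monomial p (1 : K) ∈ idealStar (toricIdeal K n) := by
  have hcomp (e : ℕ) (he : e ≤ p.degree) :
      homogeneousComponent e (monomial p (1 : K) - monomial q 1) =
        if e = p.degree then monomial p 1 else 0 := by
    rw [map_sub, homogeneousComponent_of_mem (isHomogeneous_monomial 1 rfl),
      homogeneousComponent_of_mem (isHomogeneous_monomial 1 rfl), if_neg (by omega : e ≠ q.degree),
      sub_zero]
  refine Ideal.subset_span ⟨_, monomial_sub_monomial_mem_toricIdeal h, ?_, p.degree,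
    fun e he => ?_, ?_, ?_⟩
  · rw [sub_ne_zero]
    intro heq
    rw [monomial_left_inj one_ne_zero] at heq
    exact hd.ne (by rw [heq])
  · rw [hcomp e he.le, if_neg he.ne]
  · rw [hcomp _ le_rfl, if_pos rfl]
    simp
  · rw [hcomp _ le_rfl, if_pos rfl]

theorem monomial_sub_monomial_mem_idealStar {K : Type*} [Field K] {n : Fin 4 → ℕ}
    {p q : Fin 4 →₀ ℕ} (h : Finsupp.weight n p = Finsupp.weight n q) (hd : p.degree = q.degree)
    (hpq : p ≠ q) :
    monomial p (1 : K) - monomial q 1 ∈ idealStar (toricIdeal K n) := by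
  have hne : monomial p (1 : K) - monomial q 1 ≠ 0 := by
    rwa [sub_ne_zero, Ne, monomial_left_inj one_ne_zero]
  have hcomp (e : ℕ) : homogeneousComponent e (monomial p (1 : K) - monomial q 1) =
      if e = p.degree then monomial p 1 - monomial q 1 else 0 :=
    homogeneousComponent_of_mem
      (Submodule.sub_mem _ (isHomogeneous_monomial 1 rfl) (isHomogeneous_monomial 1 hd.symm))
  refine Ideal.subset_span ⟨_, monomial_sub_monomial_mem_toricIdeal h, hne, p.degree,
    fun e he => ?_, ?_, ?_⟩
  · rw [hcomp, if_neg he.ne]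
  · rwa [hcomp, if_pos rfl]
  · rw [hcomp, if_pos rfl]

/-- A linear surjection `L` from an ideal `J` onto `K ^ k` through which the polynomial ring acts
by constant terms forces `J` to need at least `k` generators. -/
theorem le_card_of_span_eq {K σ : Type*} [Field K] {k : ℕ} {J : Ideal (MvPolynomial σ K)}
    (L : MvPolynomial σ K →ₗ[K] (Fin k → K))
    (hL : ∀ g ∈ J, ∀ p, L (p * g) = constantCoeff p • L g)
    (hsurj : ∀ i, ∃ g ∈ J, L g = Pi.single i 1)
    (s : Finset (MvPolynomial σ K)) (hs : J = Ideal.span (s : Set (MvPolynomial σ K))) :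
    k ≤ s.card := by
  classical
  have hmem : ∀ g ∈ J, L g ∈ Submodule.span K (L '' s) := by
    intro g hg
    rw [hs] at hg
    obtain ⟨c, -, rfl⟩ := Submodule.mem_span_finset.1 hg
    rw [map_sum]
    refine Submodule.sum_mem _ fun a ha => ?_
    rw [smul_eq_mul, hL a (hs ▸ Ideal.subset_span ha)]
    exact Submodule.smul_mem _ _ (Submodule.subset_span ⟨a, ha, rfl⟩)
  have htop : Submodule.span K ((s.image L : Finset (Fin k → K)) : Set (Fin k → K)) = ⊤ := by
    rw [eq_top_iff, ← (Pi.basisFun K (Fin k)).span_eq, Submodule.span_le]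
    rintro _ ⟨i, rfl⟩
    obtain ⟨g, hg, hgi⟩ := hsurj i
    rw [Pi.basisFun_apply, ← hgi, Finset.coe_image]
    exact hmem g hg
  have := finrank_span_finset_le_card (R := K) (s.image L)
  rw [Set.finrank, htop, finrank_top, Module.finrank_fin_fun] at this
  exact this.trans Finset.card_image_le

/-- The exponent vector of the monomial `x₁ⁱ x₂ʲ x₃ᵏ x₄ˡ`. -/
noncomputable def expVec (i j k l : ℕ) : Fin 4 →₀ ℕ :=
  Finsupp.equivFunOnFinite.symm ![i, j, k, l]

theorem monomial_expVec (K : Type*) [Field K] (i j k l : ℕ) :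
    monomial (expVec i j k l) (1 : K) = X 0 ^ i * X 1 ^ j * X 2 ^ k * X 3 ^ l := by
  rw [monomial_eq, Finsupp.prod_fintype _ _ (by simp), Fin.prod_univ_four]
  simp [expVec]

theorem weight_fin_four (n : Fin 4 → ℕ) (m : Fin 4 →₀ ℕ) :
    Finsupp.weight n m = m 0 * n 0 + m 1 * n 1 + m 2 * n 2 + m 3 * n 3 := by
  rw [Finsupp.weight_apply, Finsupp.sum_fintype _ _ (by simp), Fin.sum_univ_four]
  simp

theorem degree_fin_four (m : Fin 4 →₀ ℕ) : m.degree = m 0 + m 1 + m 2 + m 3 := by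
  rw [Finsupp.degree_eq_sum, Fin.sum_univ_four]

theorem expVec_le_iff {i j k l : ℕ} {m : Fin 4 →₀ ℕ} :
    expVec i j k l ≤ m ↔ i ≤ m 0 ∧ j ≤ m 1 ∧ k ≤ m 2 ∧ l ≤ m 3 := by
  rw [Finsupp.le_def]
  simp [Fin.forall_fin_succ, expVec]

@[simp] theorem expVec_zero (i j k l : ℕ) : expVec i j k l 0 = i := rfl
@[simp] theorem expVec_one (i j k l : ℕ) : expVec i j k l 1 = j := rfl
@[simp] theorem expVec_two (i j k l : ℕ) : expVec i j k l 2 = k := rfl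
@[simp] theorem expVec_three (i j k l : ℕ) : expVec i j k l 3 = l := rfl

/-- Exponents of the standard monomials. -/
def stdExponents (a1 a2 a3 v1 v2 : ℕ) : Set (Fin 4 →₀ ℕ) :=
  {m | m 1 < a2 ∧ m 2 < a3 ∧ (m 0 < v1 ∨ m 1 < v2) ∧ m 0 < a1 + v1}

/-- If `a₁, a₂` are coprime, the pair `(i, j)` is determined by `a₂ i + a₁ j + V q` in the range
of standard exponents, where `V = a₁ v₂ + v₁ a₂`. -/
theorem eq_of_weight_eq {a1 a2 v1 v2 i j i' j' q : ℕ} (hco : Nat.Coprime a1 a2)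
    (ha1 : 0 < a1) (hj : j < a2) (hj' : j' < a2) (hi' : i' < a1 + v1)
    (hstd' : i' < v1 ∨ j' < v2)
    (h : a2 * i + a1 * j + (a1 * v2 + v1 * a2) * q = a2 * i' + a1 * j') :
    i = i' ∧ j = j' ∧ q = 0 := by
  have hZ : (a2 : ℤ) * (i + v1 * q - i') = a1 * (j' - j - v2 * q) := by
    have : ((a2 * i + a1 * j + (a1 * v2 + v1 * a2) * q : ℕ) : ℤ) = (a2 * i' + a1 * j' : ℕ) :=
      congrArg _ h
    push_cast at this
    linear_combination this
  have hcoZ : IsCoprime (a1 : ℤ) a2 := Nat.isCoprime_iff_coprime.2 hco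
  obtain ⟨t, ht⟩ : (a1 : ℤ) ∣ i + v1 * q - i' := hcoZ.dvd_of_dvd_mul_left ⟨_, hZ⟩
  have ha1Z : (a1 : ℤ) ≠ 0 := by positivity
  have ht' : (j' : ℤ) - j - v2 * q = a2 * t := by
    apply mul_left_cancel₀ ha1Z
    rw [← hZ, ht]; ring
  have hq : q = 0 ∨ (v1 : ℤ) ≤ v1 * q ∧ (v2 : ℤ) ≤ v2 * q := by
    rcases Nat.eq_zero_or_pos q with h0 | h0
    · exact Or.inl h0
    · exact Or.inr ⟨by exact_mod_cast Nat.le_mul_of_pos_right _ h0,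
        by exact_mod_cast Nat.le_mul_of_pos_right _ h0⟩
  have hv2q : (0 : ℤ) ≤ v2 * q := by positivity
  have hv1q : (0 : ℤ) ≤ v1 * q := by positivity
  rcases lt_trichotomy t 0 with h0 | rfl | h0
  · have h1 : (a1 : ℤ) * t ≤ -a1 := by nlinarith
    have h2 : (a2 : ℤ) * t ≤ -a2 := by nlinarith
    rcases hq with rfl | hq
    · simp at ht'
      omega
    · omega
  · rcases hq with rfl | hq
    · simp at ht ht'
      omega
    · omega
  · have h2 : (a2 : ℤ) ≤ a2 * t := by nlinarith
    omega

/-- Standard exponents are determined by their weight. -/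
theorem injOn_weight_stdExponents {a1 a2 a3 a4 u1 u2 v1 v2 : ℕ} (ha1 : 0 < a1)
    (ha3 : 0 < a3) (ha4 : 0 < a4) {n : Fin 4 → ℕ}
    (hn : n = ![a2 * a3 * a4, a1 * a3 * a4, a4 * (a1 * u2 + u1 * a2), a3 * (a1 * v2 + v1 * a2)])
    (hgcd : Nat.gcd (Nat.gcd (Nat.gcd (n 0) (n 1)) (n 2)) (n 3) = 1) :
    Set.InjOn (Finsupp.weight n) (stdExponents a1 a2 a3 v1 v2) := by
  have h0 : n 0 = a2 * a3 * a4 := by rw [hn]; rfl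
  have h1 : n 1 = a1 * a3 * a4 := by rw [hn]; rfl
  have h2 : n 2 = a4 * (a1 * u2 + u1 * a2) := by rw [hn]; rfl
  have h3 : n 3 = a3 * (a1 * v2 + v1 * a2) := by rw [hn]; rfl
  rw [h0, h1, h2, h3] at hgcd
  have hunit (p : ℕ) (e0 : p ∣ a2 * a3 * a4) (e1 : p ∣ a1 * a3 * a4)
      (e2 : p ∣ a4 * (a1 * u2 + u1 * a2)) (e3 : p ∣ a3 * (a1 * v2 + v1 * a2)) : p = 1 :=
    Nat.dvd_one.1 (hgcd ▸ Nat.dvd_gcd (Nat.dvd_gcd (Nat.dvd_gcd e0 e1) e2) e3)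
  have hc12 : Nat.Coprime a1 a2 := by
    have d1 := Nat.gcd_dvd_left a1 a2
    have d2 := Nat.gcd_dvd_right a1 a2
    exact hunit _ ((d2.mul_right _).mul_right _) ((d1.mul_right _).mul_right _)
      (((d1.mul_right _).add (d2.mul_left _)).mul_left _)
      (((d1.mul_right _).add (d2.mul_left _)).mul_left _)
  have hc3 : Nat.Coprime a3 (a4 * (a1 * u2 + u1 * a2)) := by
    have d1 := Nat.gcd_dvd_left a3 (a4 * (a1 * u2 + u1 * a2))
    exact hunit _ ((d1.mul_left _).mul_right _) ((d1.mul_left _).mul_right _)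
      (Nat.gcd_dvd_right _ _) (d1.mul_right _)
  have hc4 : Nat.Coprime a4 (a1 * v2 + v1 * a2) := by
    have d1 := Nat.gcd_dvd_left a4 (a1 * v2 + v1 * a2)
    exact hunit _ (d1.mul_left _) (d1.mul_left _) (d1.mul_right _)
      ((Nat.gcd_dvd_right _ _).mul_left _)
  suffices key : ∀ m ∈ stdExponents a1 a2 a3 v1 v2, ∀ m' ∈ stdExponents a1 a2 a3 v1 v2,
      Finsupp.weight n m = Finsupp.weight n m' → m' 3 ≤ m 3 → m = m' by
    intro m hm m' hm' h
    rcases le_total (m' 3) (m 3) with hle | hle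
    · exact key m hm m' hm' h hle
    · exact (key m' hm' m hm h.symm hle).symm
  rintro m ⟨hm1, hm2, -, -⟩ m' ⟨hm1', hm2', hstd', hm0'⟩ h hle
  rw [weight_fin_four, weight_fin_four, h0, h1, h2, h3] at h
  have e2 : m 2 = m' 2 := by
    have hmod : a4 * (a1 * u2 + u1 * a2) * m 2 ≡ a4 * (a1 * u2 + u1 * a2) * m' 2 [MOD a3] := by
      rw [Nat.modEq_iff_dvd]
      refine ⟨m 0 * (a2 * a4) + m 1 * (a1 * a4) + m 3 * (a1 * v2 + v1 * a2)
        - (m' 0 * (a2 * a4) + m' 1 * (a1 * a4) + m' 3 * (a1 * v2 + v1 * a2)), ?_⟩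
      zify at h
      push_cast
      linear_combination -h
    exact (Nat.ModEq.cancel_left_of_coprime hc3 hmod).eq_of_lt_of_lt hm2 hm2'
  have h' : a4 * (a2 * m 0 + a1 * m 1) + (a1 * v2 + v1 * a2) * m 3 =
      a4 * (a2 * m' 0 + a1 * m' 1) + (a1 * v2 + v1 * a2) * m' 3 := by
    apply Nat.eq_of_mul_eq_mul_left ha3
    rw [e2] at h
    linarith
  obtain ⟨d, hd⟩ := Nat.exists_eq_add_of_le hle
  have h'' : a4 * (a2 * m 0 + a1 * m 1) + (a1 * v2 + v1 * a2) * d =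
      a4 * (a2 * m' 0 + a1 * m' 1) := by
    rw [hd] at h'
    linarith
  obtain ⟨q, rfl⟩ : a4 ∣ d := hc4.dvd_of_dvd_mul_left
    ((Nat.dvd_add_right (Dvd.intro _ rfl)).1 (h'' ▸ Dvd.intro _ rfl))
  obtain ⟨e0, e1, rfl⟩ := eq_of_weight_eq hc12 ha1 hm1 hm1' hm0' hstd' (i := m 0) (q := q) <| by
    apply Nat.eq_of_mul_eq_mul_left ha4
    linarith
  ext i
  fin_cases i
  · exact e0
  · exact e1
  · exact e2
  · simpa using hd

/-- The exponent `m` rewrites to the exponent `s` modulo `J`, weakly increasing the degree. -/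
def Reduces {K : Type*} [Field K] (J : Ideal (MvPolynomial (Fin 4) K)) (n : Fin 4 → ℕ)
    (m s : Fin 4 →₀ ℕ) : Prop :=
  Finsupp.weight n s = Finsupp.weight n m ∧
    (m.degree < s.degree ∧ monomial m (1 : K) ∈ J ∨
      m.degree = s.degree ∧ monomial m (1 : K) - monomial s 1 ∈ J)

namespace Reduces

variable {K : Type*} [Field K] {J : Ideal (MvPolynomial (Fin 4) K)} {n : Fin 4 → ℕ}
  {m p q s : Fin 4 →₀ ℕ}

theorem refl (m : Fin 4 →₀ ℕ) : Reduces J n m m :=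
  ⟨rfl, Or.inr ⟨rfl, by simp⟩⟩

theorem trans (h₁ : Reduces J n m p) (h₂ : Reduces J n p s) : Reduces J n m s := by
  obtain ⟨w₁, h₁⟩ := h₁
  obtain ⟨w₂, h₂⟩ := h₂
  refine ⟨w₂.trans w₁, ?_⟩
  rcases h₁ with ⟨d₁, h₁⟩ | ⟨d₁, h₁⟩ <;> rcases h₂ with ⟨d₂, h₂⟩ | ⟨d₂, h₂⟩
  · exact Or.inl ⟨d₁.trans d₂, h₁⟩
  · exact Or.inl ⟨d₁.trans_eq d₂, h₁⟩
  · exact Or.inl ⟨d₁.trans_lt d₂, by simpa using J.add_mem h₁ h₂⟩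
  · exact Or.inr ⟨d₁.trans d₂, by simpa using J.add_mem h₁ h₂⟩

theorem add_left (r : Fin 4 →₀ ℕ) (h : Reduces J n p q) : Reduces J n (r + p) (r + q) := by
  obtain ⟨w, h⟩ := h
  have hmul (m : Fin 4 →₀ ℕ) : monomial (r + m) (1 : K) = monomial r 1 * monomial m 1 := by
    simp [monomial_mul]
  refine ⟨by simp [w], ?_⟩
  rw [map_add, map_add, hmul, hmul, ← mul_sub]
  exact h.imp (fun h => ⟨by simpa using h.1, J.mul_mem_left _ h.2⟩)
    fun h => ⟨by simpa using h.1, J.mul_mem_left _ h.2⟩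

theorem of_le (h : Reduces J n p q) (hp : p ≤ m) :
    ∃ r, m = r + p ∧ Reduces J n m (r + q) := by
  obtain ⟨r, rfl⟩ := exists_add_of_le hp
  exact ⟨r, add_comm _ _, add_comm p r ▸ h.add_left r⟩

end Reduces

/-- Every monomial reduces to a standard one. -/
theorem exists_reduces_stdExponents {K : Type*} [Field K] {J : Ideal (MvPolynomial (Fin 4) K)}
    {n : Fin 4 → ℕ} (hpos : ∀ i, 0 < n i) {a1 a2 a3 a4 u1 u2 v1 v2 : ℕ}
    (ha21 : a2 < a1) (ha3u : a3 < u1 + u2) (hv : v1 + v2 < a4) (hav : 0 < a1 + v1)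
    (h1 : Reduces J n (expVec 0 a2 0 0) (expVec a1 0 0 0))
    (h2 : Reduces J n (expVec 0 0 a3 0) (expVec u1 u2 0 0))
    (h3 : Reduces J n (expVec v1 v2 0 0) (expVec 0 0 0 a4))
    (h4 : Reduces J n (expVec (a1 + v1) 0 0 0) (expVec 0 (a2 - v2) 0 a4))
    (m : Fin 4 →₀ ℕ) : ∃ s ∈ stdExponents a1 a2 a3 v1 v2, Reduces J n m s := by
  by_cases hm : m ∈ stdExponents a1 a2 a3 v1 v2
  · exact ⟨m, hm, .refl m⟩
  obtain ⟨m', hm', hlt⟩ : ∃ m', Reduces J n m m' ∧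
      (m.degree < m'.degree ∨ m.degree = m'.degree ∧ m' 0 < m 0) := by
    have hcases : a2 ≤ m 1 ∨ a3 ≤ m 2 ∨ (v1 ≤ m 0 ∧ v2 ≤ m 1) ∨ a1 + v1 ≤ m 0 := by
      by_contra! h
      exact hm ⟨h.1, h.2.1, by have := h.2.2.1; omega, h.2.2.2⟩
    rcases hcases with h | h | h | h
    · obtain ⟨r, rfl, hr⟩ := h1.of_le (m := m) (expVec_le_iff.2 (by simpa using h))
      exact ⟨_, hr, Or.inl (by simp [degree_fin_four]; omega)⟩
    · obtain ⟨r, rfl, hr⟩ := h2.of_le (m := m) (expVec_le_iff.2 (by simpa using h))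
      exact ⟨_, hr, Or.inl (by simp [degree_fin_four]; omega)⟩
    · obtain ⟨r, rfl, hr⟩ := h3.of_le (m := m) (expVec_le_iff.2 (by simpa using h))
      exact ⟨_, hr, Or.inl (by simp [degree_fin_four]; omega)⟩
    · obtain ⟨r, rfl, hr⟩ := h4.of_le (m := m) (expVec_le_iff.2 (by simpa using h))
      have hle : (r + expVec (a1 + v1) 0 0 0).degree ≤ (r + expVec 0 (a2 - v2) 0 a4).degree :=
        hr.2.elim (fun h => h.1.le) fun h => h.1.le
      exact ⟨_, hr, hle.lt_or_eq.imp id fun h => ⟨h, by simp; omega⟩⟩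
  have hbound : m'.degree ≤ Finsupp.weight n m := by
    rw [← hm'.1, weight_fin_four, degree_fin_four]
    gcongr <;> exact Nat.le_mul_of_pos_right _ (hpos _)
  have hw := hm'.1
  obtain ⟨s, hs, hms⟩ := exists_reduces_stdExponents hpos ha21 ha3u hv hav h1 h2 h3 h4 m'
  exact ⟨s, hs, hm'.trans hms⟩
termination_by (Finsupp.weight n m - m.degree, m 0)
decreasing_by
  rw [Prod.lex_def]
  dsimp only
  omega

/-- The generators of the initial ideal. -/
theorem idealStar_toricIdeal_eq (K : Type*) [Field K] {a1 a2 a3 a4 u1 u2 v1 v2 : ℕ}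
    (ha1 : 0 < a1) (ha2 : 0 < a2) (ha3 : 0 < a3) (ha4 : 0 < a4)
    (hu : ¬(u1 = 0 ∧ u2 = 0)) (hv1 : 0 < v1) (ha21 : a2 < a1) (ha3u : a3 < u1 + u2)
    (hv2a2 : v2 < a2) (heq : a1 + v1 = a2 - v2 + a4) {n : Fin 4 → ℕ}
    (hn : n = ![a2 * a3 * a4, a1 * a3 * a4, a4 * (a1 * u2 + u1 * a2), a3 * (a1 * v2 + v1 * a2)])
    (hgcd : Nat.gcd (Nat.gcd (Nat.gcd (n 0) (n 1)) (n 2)) (n 3) = 1) :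
    idealStar (toricIdeal K n) =
      Ideal.span {monomial (expVec 0 a2 0 0) (1 : K), monomial (expVec 0 0 a3 0) 1,
        monomial (expVec v1 v2 0 0) 1,
        monomial (expVec (a1 + v1) 0 0 0) 1 - monomial (expVec 0 (a2 - v2) 0 a4) 1} := by
  have h0 : n 0 = a2 * a3 * a4 := by rw [hn]; rfl
  have h1 : n 1 = a1 * a3 * a4 := by rw [hn]; rfl
  have h2 : n 2 = a4 * (a1 * u2 + u1 * a2) := by rw [hn]; rfl
  have h3 : n 3 = a3 * (a1 * v2 + v1 * a2) := by rw [hn]; rfl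
  have hU : 0 < a1 * u2 + u1 * a2 := by
    rcases Nat.eq_zero_or_pos u1 with rfl | h
    · have : 0 < u2 := by omega
      positivity
    · positivity
  have hpos : ∀ i, 0 < n i := by
    intro i
    fin_cases i <;> simp only [Fin.zero_eta, Fin.mk_one, Fin.reduceFinMk, h0, h1, h2, h3] <;>
      positivity
  obtain ⟨c, rfl⟩ := Nat.exists_eq_add_of_lt hv2a2
  have hsub : v2 + c + 1 - v2 = c + 1 := by omega
  rw [hsub] at heq ⊢
  have w1 : Finsupp.weight n (expVec 0 (v2 + c + 1) 0 0) = Finsupp.weight n (expVec a1 0 0 0) := by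
    simp [weight_fin_four, h0, h1]; ring
  have w2 : Finsupp.weight n (expVec 0 0 a3 0) = Finsupp.weight n (expVec u1 u2 0 0) := by
    simp [weight_fin_four, h0, h1, h2]; ring
  have w3 : Finsupp.weight n (expVec v1 v2 0 0) = Finsupp.weight n (expVec 0 0 0 a4) := by
    simp [weight_fin_four, h0, h1, h3]; ring
  have w4 : Finsupp.weight n (expVec (a1 + v1) 0 0 0) =
      Finsupp.weight n (expVec 0 (c + 1) 0 a4) := by
    simp [weight_fin_four, h0, h1, h3]; ring
  have d1 : (expVec 0 (v2 + c + 1) 0 0).degree < (expVec a1 0 0 0).degree := by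
    simp [degree_fin_four]; omega
  have d2 : (expVec 0 0 a3 0).degree < (expVec u1 u2 0 0).degree := by
    simp [degree_fin_four]; omega
  have d3 : (expVec v1 v2 0 0).degree < (expVec 0 0 0 a4).degree := by
    simp [degree_fin_four]; omega
  have d4 : (expVec (a1 + v1) 0 0 0).degree = (expVec 0 (c + 1) 0 a4).degree := by
    simp [degree_fin_four]; omega
  apply le_antisymm
  · refine idealStar_toricIdeal_le n _ _
      (injOn_weight_stdExponents ha1 ha3 ha4 hn hgcd) fun m => ?_
    refine exists_reduces_stdExponents (a4 := a4) hpos ha21 ha3u (by omega) (by omega)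
      ⟨w1.symm, Or.inl ⟨d1, Ideal.subset_span (by simp)⟩⟩
      ⟨w2.symm, Or.inl ⟨d2, Ideal.subset_span (by simp)⟩⟩
      ⟨w3.symm, Or.inl ⟨d3, Ideal.subset_span (by simp)⟩⟩ ?_ m
    rw [hsub]
    exact ⟨w4.symm, Or.inr ⟨d4, Ideal.subset_span (by simp)⟩⟩
  · rw [Ideal.span_le]
    rintro g (rfl | rfl | rfl | rfl)
    · exact monomial_mem_idealStar w1 d1
    · exact monomial_mem_idealStar w2 d2
    · exact monomial_mem_idealStar w3 d3
    · refine monomial_sub_monomial_mem_idealStar w4 d4 fun h => ?_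
      have := DFunLike.congr_fun h 1
      simp at this

/-- The initial ideal needs at least four generators. -/
theorem four_le_card_of_span_eq {K : Type*} [Field K] {a2 a3 v1 v2 b c d : ℕ}
    (ha2 : 0 < a2) (ha3 : 0 < a3) (hv1 : 0 < v1) (hv2 : 0 < v2) (hv2a2 : v2 < a2)
    (hb : v1 < b) (hc : 0 < c) (hd : 0 < d) (s : Finset (MvPolynomial (Fin 4) K))
    (hs : Ideal.span {monomial (expVec 0 a2 0 0) (1 : K), monomial (expVec 0 0 a3 0) 1,
        monomial (expVec v1 v2 0 0) 1,
        monomial (expVec b 0 0 0) 1 - monomial (expVec 0 c 0 d) 1} =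
      Ideal.span (s : Set (MvPolynomial (Fin 4) K))) : 4 ≤ s.card := by
  have hinj {i j k l i' j' k' l' : ℕ} : expVec i j k l = expVec i' j' k' l' ↔
      i = i' ∧ j = j' ∧ k = k' ∧ l = l' := by
    rw [DFunLike.ext_iff]
    simp [Fin.forall_fin_succ, expVec]
  let e : Fin 4 → (Fin 4 →₀ ℕ) :=
    ![expVec 0 a2 0 0, expVec 0 0 a3 0, expVec v1 v2 0 0, expVec b 0 0 0]
  let L : MvPolynomial (Fin 4) K →ₗ[K] (Fin 4 → K) := LinearMap.pi fun i => lcoeff K (e i)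
  have hLapp (f : MvPolynomial (Fin 4) K) (i : Fin 4) : L f i = coeff (e i) f := rfl
  have hLmon (m : Fin 4 →₀ ℕ) (hm : ∀ i, m ≤ e i → m = e i) (p : MvPolynomial (Fin 4) K) :
      L (p * monomial m 1) = constantCoeff p • L (monomial m 1) := by
    classical
    ext i
    rw [Pi.smul_apply, hLapp, hLapp, coeff_mul_monomial', coeff_monomial]
    by_cases h : m ≤ e i
    · simp [hm i h, constantCoeff_eq]
    · rw [if_neg h, if_neg (fun h' => h h'.le)]
      simp
  have he1 : ∀ i, expVec 0 a2 0 0 ≤ e i → expVec 0 a2 0 0 = e i := by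
    intro i
    fin_cases i <;> simp [e, expVec_le_iff, hinj] <;> omega
  have he2 : ∀ i, expVec 0 0 a3 0 ≤ e i → expVec 0 0 a3 0 = e i := by
    intro i
    fin_cases i <;> simp [e, expVec_le_iff, hinj] <;> omega
  have he3 : ∀ i, expVec v1 v2 0 0 ≤ e i → expVec v1 v2 0 0 = e i := by
    intro i
    fin_cases i <;> simp [e, expVec_le_iff, hinj] <;> omega
  have he4 : ∀ i, expVec b 0 0 0 ≤ e i → expVec b 0 0 0 = e i := by
    intro i
    fin_cases i <;> simp [e, expVec_le_iff, hinj] <;> omega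
  have he5 : ∀ i, ¬ expVec 0 c 0 d ≤ e i := by
    intro i
    fin_cases i <;> simp [e, expVec_le_iff] <;> omega
  have hL5 : L (monomial (expVec 0 c 0 d) 1) = 0 := by
    classical
    ext i
    rw [hLapp, coeff_monomial, if_neg (fun h => he5 i h.le)]
    rfl
  have heinj : Function.Injective e := by
    intro i j
    fin_cases i <;> fin_cases j <;> simp [e, hinj] <;> omega
  have hLe (i : Fin 4) : L (monomial (e i) 1) = Pi.single i 1 := by
    classical
    ext j
    simp [hLapp, coeff_monomial, Pi.single_apply, heinj.eq_iff, eq_comm]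
  refine le_card_of_span_eq L ?_ ?_ s hs
  · intro g hg
    induction hg using Submodule.span_induction with
    | mem g hg =>
      intro p
      rcases hg with rfl | rfl | rfl | rfl
      · exact hLmon _ he1 p
      · exact hLmon _ he2 p
      · exact hLmon _ he3 p
      · rw [mul_sub, map_sub, map_sub, hLmon _ he4, hLmon _ (fun i h => absurd h (he5 i)), smul_sub]
    | zero => simp
    | add x y _ _ hx hy => intro p; rw [mul_add, map_add, map_add, hx, hy, smul_add]
    | smul a x _ hx =>
      intro p
      rw [smul_eq_mul, ← mul_assoc, hx, hx, map_mul, mul_smul]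
  · intro i
    fin_cases i
    · exact ⟨_, Ideal.subset_span (by simp [e]), hLe 0⟩
    · exact ⟨_, Ideal.subset_span (by simp [e]), hLe 1⟩
    · exact ⟨_, Ideal.subset_span (by simp [e]), hLe 2⟩
    · exact ⟨monomial (expVec b 0 0 0) 1 - monomial (expVec 0 c 0 d) 1,
        Ideal.subset_span (by simp), by rw [map_sub, hL5, sub_zero]; exact hLe 3⟩

theorem stmt17 (K : Type*) [Field K] (a1 a2 a3 a4 u1 u2 v1 v2 v3 : ℕ)
    (ha1 : 0 < a1) (ha2 : 0 < a2) (ha3 : 0 < a3) (ha4 : 0 < a4)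
    (hu12 : ¬(u1 = 0 ∧ u2 = 0)) (hv123 : ¬(v1 = 0 ∧ v2 = 0 ∧ v3 = 0))
    (n : Fin 4 → ℕ)
    (hn : n = ![a2 * a3 * a4, a1 * a3 * a4, a4 * (a1 * u2 + u1 * a2),
      v3 * (a1 * u2 + a2 * u1) + a3 * (a1 * v2 + v1 * a2)])
    (hv3 : v3 = 0) (hv1 : 0 < v1) (hv2 : 0 < v2)
    (hgcd : Nat.gcd (Nat.gcd (Nat.gcd (n 0) (n 1)) (n 2)) (n 3) = 1)
    (ha21 : a2 < a1) (ha3u : a3 < u1 + u2) (hv2a2 : v2 < a2)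
    (heq : a1 + v1 = a2 - v2 + a4)
    (b : Fin 4 → ℕ)
    (hb : b = ![a2 * a3, a1 * a3, a1 * u2 + u1 * a2, a2 * a3]) :
    ∀ w : ℕ,
      Nat.gcd (Nat.gcd (Nat.gcd (n 0 + w * b 0) (n 1 + w * b 1))
        (n 2 + w * b 2)) (n 3 + w * b 3) = 1 →
      idealStar (toricIdeal K (fun j => n j + w * b j)) =
        Ideal.span {(X 1 : MvPolynomial (Fin 4) K) ^ a2, X 2 ^ a3,
          X 0 ^ (v1 + w) * X 1 ^ v2,
          X 0 ^ (a1 + v1 + w) - X 1 ^ (a2 - v2) * X 3 ^ (a4 + w)} ∧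
      ¬∃ s : Finset (MvPolynomial (Fin 4) K), s.card < 4 ∧
        idealStar (toricIdeal K (fun j => n j + w * b j)) =
          Ideal.span (s : Set (MvPolynomial (Fin 4) K)) := by
  intro w hgcdw
  have hN : (fun j => n j + w * b j) = ![a2 * a3 * (a4 + w), a1 * a3 * (a4 + w),
      (a4 + w) * (a1 * u2 + u1 * a2), a3 * (a1 * v2 + (v1 + w) * a2)] := by
    subst hn hb hv3
    ext j
    fin_cases j <;> simp <;> ring
  have hstar := idealStar_toricIdeal_eq K ha1 ha2 ha3 (by omega) hu12 (by omega) ha21 ha3u hv2a2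
    (by omega) hN hgcdw
  rw [hstar]
  refine ⟨by simp [monomial_expVec, add_assoc], ?_⟩
  rintro ⟨s, hs, hspan⟩
  exact hs.not_ge (four_le_card_of_span_eq ha2 ha3 (by omega) hv2 hv2a2 (by omega) (by omega)
    (by omega) s hspan)
end

section
/- Let m ≥ 1 and w ≥ 0 be integers and set n' = (8m² + 6 + 4w, 20m² + 15 + 10w, 12m² + 15 + 6w, 8m² + 10 + 4w). If the four entries of n' have greatest common divisor 1, then the ideal I(n')_* equals the ideal of K[x1,x2,x3,x4] generated by x2², x3², x4^{4m²+2w+3}, x1^{2m²+w}x2x3, x1^{2m²+w}x2 − x3x4^{2m²+w} and x2x4^{2m²+w+3}. -/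
open MvPolynomial

/-- Exponent vectors of equal weight differ by an integer multiple of the gluing relation. -/
theorem exists_gluing_multiple {a A A' B B' : ℤ}
    (h : (2 * a + 3) * A + (2 * a + 5) * B = (2 * a + 3) * A' + (2 * a + 5) * B') :
    ∃ k : ℤ, A - A' = (2 * a + 5) * k ∧ B' - B = (2 * a + 3) * k :=
  ⟨(a + 2) * (B' - B) - (a + 1) * (A - A'),
    by linear_combination (a + 2) * h,
    by linear_combination (a + 1) * h⟩

/-- The integer equations satisfied by two exponent vectors of equal weight, with the product
`a * k` isolated as `t`. -/
theorem exists_exponent_relation {a u0 u1 u2 u3 v0 v1 v2 v3 : ℕ}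
    (h : (2 * a + 3) * (2 * u0 + 5 * u1) + (2 * a + 5) * (3 * u2 + 2 * u3) =
      (2 * a + 3) * (2 * v0 + 5 * v1) + (2 * a + 5) * (3 * v2 + 2 * v3)) :
    ∃ k t : ℤ, (2 * u0 + 5 * u1 - (2 * v0 + 5 * v1) : ℤ) = 2 * t + 5 * k ∧
      (3 * v2 + 2 * v3 - (3 * u2 + 2 * u3) : ℤ) = 2 * t + 3 * k ∧
      ((k = 0 ∧ t = 0) ∨ (k = 1 ∧ t = a) ∨ (k = -1 ∧ t = -a) ∨
        (2 ≤ k ∧ 2 * a ≤ t) ∨ (k ≤ -2 ∧ t ≤ -(2 * a))) := by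
  zify at h
  obtain ⟨k, h1, h2⟩ := exists_gluing_multiple h
  refine ⟨k, a * k, by linear_combination h1, by linear_combination h2, ?_⟩
  have ha : (0 : ℤ) ≤ a := by positivity
  obtain hk | rfl | rfl | rfl | hk : k ≤ -2 ∨ k = -1 ∨ k = 0 ∨ k = 1 ∨ 2 ≤ k := by omega
  · right; right; right; right
    exact ⟨hk, by nlinarith⟩
  · simp
  · simp
  · simp
  · right; right; right; left
    exact ⟨hk, by nlinarith⟩

theorem exponents_of_degree_lt {a u0 u1 u2 u3 v0 v1 v2 v3 : ℕ}
    (h : (2 * a + 3) * (2 * u0 + 5 * u1) + (2 * a + 5) * (3 * u2 + 2 * u3) =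
      (2 * a + 3) * (2 * v0 + 5 * v1) + (2 * a + 5) * (3 * v2 + 2 * v3))
    (hlt : u0 + u1 + u2 + u3 < v0 + v1 + v2 + v3)
    (hu1 : u1 ≤ 1) (hu2 : u2 ≤ 1) (hv1 : v1 ≤ 1) (hv2 : v2 ≤ 1) :
    2 * a + 3 ≤ u3 ∨ (a ≤ u0 ∧ 1 ≤ u1 ∧ 1 ≤ u2) ∨ (1 ≤ u1 ∧ 1 ≤ u2 ∧ a ≤ u3) ∨
      (1 ≤ u1 ∧ a + 3 ≤ u3) := by
  obtain ⟨k, t, h1, h2, h3⟩ := exists_exponent_relation h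
  clear h
  interval_cases u1 <;> interval_cases u2 <;> interval_cases v1 <;> interval_cases v2 <;>
    rcases h3 with h3 | h3 | h3 | h3 | h3 <;> omega

theorem exponents_of_degree_eq {a u0 u1 u2 u3 v0 v1 v2 v3 : ℕ}
    (h : (2 * a + 3) * (2 * u0 + 5 * u1) + (2 * a + 5) * (3 * u2 + 2 * u3) =
      (2 * a + 3) * (2 * v0 + 5 * v1) + (2 * a + 5) * (3 * v2 + 2 * v3))
    (heq : u0 + u1 + u2 + u3 = v0 + v1 + v2 + v3)
    (hu1 : u1 ≤ 1) (hu2 : u2 ≤ 1) (hv1 : v1 ≤ 1) (hv2 : v2 ≤ 1) :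
    (u0 = v0 ∧ u1 = v1 ∧ u2 = v2 ∧ u3 = v3) ∨
    (u0 = v0 + a ∧ u1 = 1 ∧ v1 = 0 ∧ u2 = 0 ∧ v2 = 1 ∧ v3 = u3 + a) ∨
    (v0 = u0 + a ∧ v1 = 1 ∧ u1 = 0 ∧ v2 = 0 ∧ u2 = 1 ∧ u3 = v3 + a) := by
  obtain ⟨k, t, h1, h2, h3⟩ := exists_exponent_relation h
  clear h
  interval_cases u1 <;> interval_cases u2 <;> interval_cases v1 <;> interval_cases v2 <;>
    rcases h3 with h3 | h3 | h3 | h3 | h3 <;> omega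

/-- Among the exponent vectors of a given weight, one of at least the given degree is reduced. -/
theorem exists_reduced_exponents (a v0 v1 v2 v3 : ℕ) :
    ∃ w0 w1 w2 w3 : ℕ, w1 ≤ 1 ∧ w2 ≤ 1 ∧
      (2 * a + 3) * (2 * v0 + 5 * v1) + (2 * a + 5) * (3 * v2 + 2 * v3) =
        (2 * a + 3) * (2 * w0 + 5 * w1) + (2 * a + 5) * (3 * w2 + 2 * w3) ∧
      v0 + v1 + v2 + v3 ≤ w0 + w1 + w2 + w3 ∧
      (2 ≤ v1 ∨ 2 ≤ v2 → v0 + v1 + v2 + v3 < w0 + w1 + w2 + w3) := by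
  refine ⟨v0 + 5 * (v1 / 2), v1 % 2, v2 % 2, v3 + 3 * (v2 / 2), by omega, by omega, ?_,
    by omega, by omega⟩
  congr 2 <;> omega

section CommRing

variable {R : Type*} [CommRing R] {J : Ideal R} {x : Fin 4 → R} {a : ℕ}

theorem mul_pow_mem_of_degree_lt
    (h1 : x 1 ^ 2 ∈ J) (h2 : x 2 ^ 2 ∈ J) (h3 : x 3 ^ (2 * a + 3) ∈ J)
    (h4 : x 0 ^ a * x 1 * x 2 ∈ J) (h5 : x 0 ^ a * x 1 - x 2 * x 3 ^ a ∈ J)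
    (h6 : x 1 * x 3 ^ (a + 3) ∈ J) {u0 u1 u2 u3 v0 v1 v2 v3 : ℕ}
    (h : (2 * a + 3) * (2 * u0 + 5 * u1) + (2 * a + 5) * (3 * u2 + 2 * u3) =
      (2 * a + 3) * (2 * v0 + 5 * v1) + (2 * a + 5) * (3 * v2 + 2 * v3))
    (hlt : u0 + u1 + u2 + u3 < v0 + v1 + v2 + v3) :
    x 0 ^ u0 * x 1 ^ u1 * x 2 ^ u2 * x 3 ^ u3 ∈ J := by
  by_cases hu1 : 2 ≤ u1
  · obtain ⟨c, rfl⟩ := Nat.exists_eq_add_of_le hu1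
    convert J.mul_mem_left (x 0 ^ u0 * x 1 ^ c * x 2 ^ u2 * x 3 ^ u3) h1 using 1
    ring
  by_cases hu2 : 2 ≤ u2
  · obtain ⟨c, rfl⟩ := Nat.exists_eq_add_of_le hu2
    convert J.mul_mem_left (x 0 ^ u0 * x 1 ^ u1 * x 2 ^ c * x 3 ^ u3) h2 using 1
    ring
  obtain ⟨w0, w1, w2, w3, hw1, hw2, hw, hle, -⟩ := exists_reduced_exponents a v0 v1 v2 v3
  rcases exponents_of_degree_lt (h.trans hw) (hlt.trans_le hle) (by omega) (by omega) hw1 hw2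
    with h' | ⟨h0, h1', h2'⟩ | ⟨h1', h2', h3'⟩ | ⟨h1', h3'⟩
  · obtain ⟨c, rfl⟩ := Nat.exists_eq_add_of_le h'
    convert J.mul_mem_left (x 0 ^ u0 * x 1 ^ u1 * x 2 ^ u2 * x 3 ^ c) h3 using 1
    ring
  · obtain ⟨c, rfl⟩ := Nat.exists_eq_add_of_le h0
    obtain rfl : u1 = 1 := by omega
    obtain rfl : u2 = 1 := by omega
    convert J.mul_mem_left (x 0 ^ c * x 3 ^ u3) h4 using 1
    ring
  · obtain ⟨c, rfl⟩ := Nat.exists_eq_add_of_le h3'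
    obtain rfl : u1 = 1 := by omega
    obtain rfl : u2 = 1 := by omega
    convert J.mul_mem_left (x 0 ^ u0 * x 3 ^ c)
      (J.sub_mem (J.mul_mem_left (x 0 ^ a) h1) (J.mul_mem_left (x 1) h5)) using 1
    ring
  · obtain ⟨c, rfl⟩ := Nat.exists_eq_add_of_le h3'
    obtain rfl : u1 = 1 := by omega
    convert J.mul_mem_left (x 0 ^ u0 * x 2 ^ u2 * x 3 ^ c) h6 using 1
    ring

theorem mul_pow_sub_mem_of_degree_eq
    (h1 : x 1 ^ 2 ∈ J) (h2 : x 2 ^ 2 ∈ J) (h3 : x 3 ^ (2 * a + 3) ∈ J)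
    (h4 : x 0 ^ a * x 1 * x 2 ∈ J) (h5 : x 0 ^ a * x 1 - x 2 * x 3 ^ a ∈ J)
    (h6 : x 1 * x 3 ^ (a + 3) ∈ J) {u0 u1 u2 u3 v0 v1 v2 v3 : ℕ}
    (h : (2 * a + 3) * (2 * u0 + 5 * u1) + (2 * a + 5) * (3 * u2 + 2 * u3) =
      (2 * a + 3) * (2 * v0 + 5 * v1) + (2 * a + 5) * (3 * v2 + 2 * v3))
    (heq : u0 + u1 + u2 + u3 = v0 + v1 + v2 + v3) :
    x 0 ^ u0 * x 1 ^ u1 * x 2 ^ u2 * x 3 ^ u3 - x 0 ^ v0 * x 1 ^ v1 * x 2 ^ v2 * x 3 ^ v3 ∈ J := by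
  by_cases hu : 2 ≤ u1 ∨ 2 ≤ u2
  · obtain ⟨w0, w1, w2, w3, -, -, hw, -, hlt⟩ := exists_reduced_exponents a u0 u1 u2 u3
    exact J.sub_mem (mul_pow_mem_of_degree_lt h1 h2 h3 h4 h5 h6 hw (hlt hu))
      (mul_pow_mem_of_degree_lt h1 h2 h3 h4 h5 h6 (h.symm.trans hw) (heq ▸ hlt hu))
  by_cases hv : 2 ≤ v1 ∨ 2 ≤ v2
  · obtain ⟨w0, w1, w2, w3, -, -, hw, -, hlt⟩ := exists_reduced_exponents a v0 v1 v2 v3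
    exact J.sub_mem (mul_pow_mem_of_degree_lt h1 h2 h3 h4 h5 h6 (h.trans hw) (heq ▸ hlt hv))
      (mul_pow_mem_of_degree_lt h1 h2 h3 h4 h5 h6 hw (hlt hv))
  rcases exponents_of_degree_eq h heq (by omega) (by omega) (by omega) (by omega)
    with ⟨rfl, rfl, rfl, rfl⟩ | ⟨rfl, rfl, rfl, rfl, rfl, rfl⟩ | ⟨rfl, rfl, rfl, rfl, rfl, rfl⟩
  · simp
  · convert J.mul_mem_left (x 0 ^ v0 * x 3 ^ u3) h5 using 1
    ring
  · convert J.neg_mem (J.mul_mem_left (x 0 ^ u0 * x 3 ^ v3) h5) using 1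
    ring

end CommRing

theorem mem_idealStar_of_add_mem {K : Type*} [Field K] {I : Ideal (MvPolynomial (Fin 4) K)}
    {g h : MvPolynomial (Fin 4) K} {d e : ℕ} (hg : g.IsHomogeneous d) (hh : h.IsHomogeneous e)
    (hde : d < e) (hg0 : g ≠ 0) (hI : g + h ∈ I) : g ∈ idealStar I := by
  have hd : homogeneousComponent d (g + h) = g := by
    rw [map_add, homogeneousComponent_of_mem hg, homogeneousComponent_of_mem hh,
      if_pos rfl, if_neg hde.ne, add_zero]
  refine Ideal.subset_span ⟨g + h, hI, ?_, d, fun c hc => ?_, by rwa [hd], hd.symm⟩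
  · intro h0
    rw [h0, map_zero] at hd
    exact hg0 hd.symm
  · rw [map_add, homogeneousComponent_of_mem hg, homogeneousComponent_of_mem hh,
      if_neg hc.ne, if_neg (hc.trans hde).ne, add_zero]

theorem monomial_fin_four {K : Type*} [Field K] (u : Fin 4 →₀ ℕ) :
    (monomial u 1 : MvPolynomial (Fin 4) K) =
      X 0 ^ u 0 * X 1 ^ u 1 * X 2 ^ u 2 * X 3 ^ u 3 := by
  rw [monomial_eq, Finsupp.prod_fintype _ _ (by simp)]
  simp [Fin.prod_univ_four]

/-- The coefficients of an element of the toric ideal over the monomials of a given weight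
add up to zero. -/
theorem sum_coeff_eq_zero_of_mem_toricIdeal {K : Type*} [Field K] {n : Fin 4 → ℕ}
    {f : MvPolynomial (Fin 4) K} (hf : f ∈ toricIdeal K n) (s : ℕ) :
    ∑ u ∈ f.support with ∑ i, n i * u i = s, coeff u f = 0 := by
  have h0 : aeval (fun i => (Polynomial.X : Polynomial K) ^ n i) f = 0 := hf
  have h1 := congrArg (fun p => Polynomial.coeff p s) h0
  simp only [aeval_def, eval₂_eq', Polynomial.finsetSum_coeff, ← pow_mul,
    Finset.prod_pow_eq_pow_sum, Polynomial.algebraMap_eq, Polynomial.coeff_C_mul,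
    Polynomial.coeff_X_pow, Polynomial.coeff_zero, mul_ite, mul_one, mul_zero] at h1
  rw [Finset.sum_filter]
  simpa only [eq_comm (a := s)] using h1

/-- An ideal contains the initial ideal of a toric ideal as soon as it contains every monomial
that is not of maximal degree in its weight, and the difference of any two monomials of the
same weight and degree. -/
theorem idealStar_toricIdeal_le_s18 {K : Type*} [Field K] {n : Fin 4 → ℕ}
    {J : Ideal (MvPolynomial (Fin 4) K)}
    (hlt : ∀ u v : Fin 4 →₀ ℕ, ∑ i, n i * u i = ∑ i, n i * v i → u.degree < v.degree →
      (monomial u 1 : MvPolynomial (Fin 4) K) ∈ J)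
    (heq : ∀ u v : Fin 4 →₀ ℕ, ∑ i, n i * u i = ∑ i, n i * v i → u.degree = v.degree →
      (monomial u 1 - monomial v 1 : MvPolynomial (Fin 4) K) ∈ J) :
    idealStar (toricIdeal K n) ≤ J := by
  refine Ideal.span_le.mpr ?_
  rintro _ ⟨f, hf, -, d, hlow, -, rfl⟩
  have hdeg : ∀ u ∈ f.support, d ≤ u.degree := by
    intro u hu
    by_contra! hc
    have := congrArg (coeff u) (hlow _ hc)
    rw [coeff_homogeneousComponent, if_pos rfl, coeff_zero] at this
    exact mem_support_iff.mp hu this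
  have hmon : ∀ u, (monomial u (coeff u f) : MvPolynomial (Fin 4) K) =
      C (coeff u f) * monomial u 1 := fun u => by rw [C_mul_monomial, mul_one]
  rw [SetLike.mem_coe, homogeneousComponent_apply,
    ← Finset.sum_fiberwise_of_maps_to
      (fun u hu => Finset.mem_image_of_mem (fun u : Fin 4 →₀ ℕ => ∑ i, n i * u i) hu)]
  refine J.sum_mem fun s _ => ?_
  by_cases hv : ∃ v ∈ f.support, ∑ i, n i * v i = s ∧ d < v.degree
  · obtain ⟨v, -, hvs, hvd⟩ := hv
    refine J.sum_mem fun u hu => ?_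
    simp only [Finset.mem_filter] at hu
    rw [hmon]
    exact J.mul_mem_left _ (hlt u v (hu.2.trans hvs.symm) (hu.1.2 ▸ hvd))
  · push Not at hv
    have hfilter : (f.support.filter fun u => u.degree = d).filter
        (fun u => ∑ i, n i * u i = s) = f.support.filter fun u => ∑ i, n i * u i = s := by
      ext u
      simp only [Finset.mem_filter]
      exact ⟨fun h => ⟨h.1.1, h.2⟩,
        fun h => ⟨⟨h.1, le_antisymm (hv u h.1 h.2) (hdeg u h.1)⟩, h.2⟩⟩
    rw [hfilter]
    obtain hempty | ⟨v, hvmem⟩ :=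
      (f.support.filter fun u => ∑ i, n i * u i = s).eq_empty_or_nonempty
    · rw [hempty, Finset.sum_empty]
      exact J.zero_mem
    have hsum : ∑ u ∈ f.support with ∑ i, n i * u i = s, monomial u (coeff u f) =
        ∑ u ∈ f.support with ∑ i, n i * u i = s,
          C (coeff u f) * (monomial u 1 - monomial v 1 : MvPolynomial (Fin 4) K) := by
      simp only [mul_sub, ← hmon, Finset.sum_sub_distrib, ← Finset.sum_mul, ← map_sum,
        sum_coeff_eq_zero_of_mem_toricIdeal hf s, map_zero, zero_mul, sub_zero]
    rw [hsum]
    refine J.sum_mem fun u hu => J.mul_mem_left _ ?_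
    rw [Finset.mem_filter] at hu hvmem
    exact heq u v (hu.2.trans hvmem.2.symm) <|
      (le_antisymm (hv u hu.1 hu.2) (hdeg u hu.1)).trans
        (le_antisymm (hv v hvmem.1 hvmem.2) (hdeg v hvmem.1)).symm

theorem stmt18 (K : Type*) [Field K] (m w : ℕ) (hm : 1 ≤ m)
    (n' : Fin 4 → ℕ)
    (hn' : n' = ![8 * m ^ 2 + 6 + 4 * w, 20 * m ^ 2 + 15 + 10 * w,
      12 * m ^ 2 + 15 + 6 * w, 8 * m ^ 2 + 10 + 4 * w])
    (hgcd : Nat.gcd (Nat.gcd (Nat.gcd (n' 0) (n' 1)) (n' 2)) (n' 3) = 1) :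
    idealStar (toricIdeal K n') =
      Ideal.span {(X 1 : MvPolynomial (Fin 4) K) ^ 2, X 2 ^ 2,
        X 3 ^ (4 * m ^ 2 + 2 * w + 3),
        X 0 ^ (2 * m ^ 2 + w) * X 1 * X 2,
        X 0 ^ (2 * m ^ 2 + w) * X 1 - X 2 * X 3 ^ (2 * m ^ 2 + w),
        X 1 * X 3 ^ (2 * m ^ 2 + w + 3)} := by
  rw [show 4 * m ^ 2 + 2 * w + 3 = 2 * (2 * m ^ 2 + w) + 3 by ring]
  have hn0 : n' 0 = (2 * (2 * m ^ 2 + w) + 3) * 2 := by rw [hn']; simp; ring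
  have hn1 : n' 1 = (2 * (2 * m ^ 2 + w) + 3) * 5 := by rw [hn']; simp; ring
  have hn2 : n' 2 = (2 * (2 * m ^ 2 + w) + 5) * 3 := by rw [hn']; simp; ring
  have hn3 : n' 3 = (2 * (2 * m ^ 2 + w) + 5) * 2 := by rw [hn']; simp; ring
  clear hn' hgcd hm
  generalize 2 * m ^ 2 + w = a at *
  have hweight : ∀ u : Fin 4 →₀ ℕ, ∑ i, n' i * u i =
      (2 * a + 3) * (2 * u 0 + 5 * u 1) + (2 * a + 5) * (3 * u 2 + 2 * u 3) := by
    intro u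
    rw [Fin.sum_univ_four, hn0, hn1, hn2, hn3]
    ring
  have hdegree : ∀ u : Fin 4 →₀ ℕ, u.degree = u 0 + u 1 + u 2 + u 3 := by
    intro u
    rw [Finsupp.degree_eq_sum, Fin.sum_univ_four]
  have hX : ∀ (i : Fin 4) (k : ℕ), (X i ^ k : MvPolynomial (Fin 4) K).IsHomogeneous k :=
    fun i k => isHomogeneous_X_pow i k
  have hX1 : ∀ i : Fin 4, (X i : MvPolynomial (Fin 4) K).IsHomogeneous 1 :=
    fun i => isHomogeneous_X K i
  refine le_antisymm ?_ (Ideal.span_le.mpr ?_)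
  · set J : Ideal (MvPolynomial (Fin 4) K) := Ideal.span _ with hJ
    have h1 : (X 1 ^ 2 : MvPolynomial (Fin 4) K) ∈ J := Ideal.subset_span (by simp)
    have h2 : (X 2 ^ 2 : MvPolynomial (Fin 4) K) ∈ J := Ideal.subset_span (by simp)
    have h3 : (X 3 ^ (2 * a + 3) : MvPolynomial (Fin 4) K) ∈ J := Ideal.subset_span (by simp)
    have h4 : (X 0 ^ a * X 1 * X 2 : MvPolynomial (Fin 4) K) ∈ J :=
      Ideal.subset_span (by simp)
    have h5 : (X 0 ^ a * X 1 - X 2 * X 3 ^ a : MvPolynomial (Fin 4) K) ∈ J :=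
      Ideal.subset_span (by simp)
    have h6 : (X 1 * X 3 ^ (a + 3) : MvPolynomial (Fin 4) K) ∈ J :=
      Ideal.subset_span (by simp)
    refine idealStar_toricIdeal_le_s18 (fun u v huv hd => ?_) (fun u v huv hd => ?_)
    · rw [hweight, hweight] at huv
      rw [hdegree, hdegree] at hd
      rw [monomial_fin_four]
      exact mul_pow_mem_of_degree_lt h1 h2 h3 h4 h5 h6 huv hd
    · rw [hweight, hweight] at huv
      rw [hdegree, hdegree] at hd
      rw [monomial_fin_four, monomial_fin_four]
      exact mul_pow_sub_mem_of_degree_eq h1 h2 h3 h4 h5 h6 huv hd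
  · have hmem : ∀ f : MvPolynomial (Fin 4) K, f ∈ toricIdeal K n' ↔
        aeval (fun i => (Polynomial.X : Polynomial K) ^ n' i) f = 0 := fun f => Iff.rfl
    rintro g (rfl | rfl | rfl | rfl | rfl | rfl)
    · refine mem_idealStar_of_add_mem (hX 1 2) (hX 0 5).neg (by norm_num) (by simp) ?_
      simp only [hmem, map_add, map_neg, map_pow, aeval_X, hn0, hn1]
      ring
    · refine mem_idealStar_of_add_mem (hX 2 2) (hX 3 3).neg (by norm_num) (by simp) ?_
      simp only [hmem, map_add, map_neg, map_pow, aeval_X, hn2, hn3]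
      ring
    · refine mem_idealStar_of_add_mem (hX 3 (2 * a + 3)) (hX 0 (2 * a + 5)).neg (by omega)
        (by simp) ?_
      simp only [hmem, map_add, map_neg, map_pow, aeval_X, hn0, hn3]
      ring
    · refine mem_idealStar_of_add_mem (((hX 0 a).mul (hX1 1)).mul (hX1 2)) (hX 3 (a + 3)).neg
        (by omega) (by simp) ?_
      simp only [hmem, map_add, map_neg, map_mul, map_pow, aeval_X, hn0, hn1, hn2, hn3]
      ring
    · refine mem_idealStar_of_add_mem (e := a + 2) (((hX 0 a).mul (hX1 1)).sub
        (add_comm 1 a ▸ (hX1 2).mul (hX 3 a))) (isHomogeneous_zero _ _ _) (by omega) ?_ ?_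
      · intro h0
        simpa using congrArg (eval ![1, 1, 0, 0]) h0
      · simp only [hmem, map_add, map_sub, map_mul, map_pow, map_zero, aeval_X, hn0, hn1, hn2, hn3]
        ring
    · refine mem_idealStar_of_add_mem ((hX1 1).mul (hX 3 (a + 3)))
        ((hX 0 (a + 5)).mul (hX1 2)).neg (by omega) (by simp) ?_
      simp only [hmem, map_add, map_neg, map_mul, map_pow, aeval_X, hn0, hn1, hn2, hn3]
      ring
end

section
/- Let m ≥ 1 and w ≥ 0 be integers and set n' = (8m² + 6 + 4w, 20m² + 15 + 10w, 12m² + 15 + 6w, 8m² + 10 + 4w). If the four entries of n' have greatest common divisor 1, then the Hilbert function of K[x1,x2,x3,x4]/I(n')_* is non-decreasing; that is, for every integer i ≥ 0, the K-vector-space dimension of the degree-i homogeneous component of the graded ring K[x1,x2,x3,x4]/I(n')_* is at most the dimension of its degree-(i+1) homogeneous component. -/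
open MvPolynomial

/-- The Hilbert function of the graded quotient `K[x₁,x₂,x₃,x₄]/I` (for a homogeneous
ideal `I`): `i ↦ dim_K` of the image of the degree-`i` homogeneous component under the
quotient map. -/
noncomputable def hilbertFn (K : Type*) [Field K] (I : Ideal (MvPolynomial (Fin 4) K))
    (i : ℕ) : ℕ :=
  Module.finrank K ((homogeneousSubmodule (Fin 4) K i).map
    (Ideal.Quotient.mkₐ K I).toLinearMap)

section ToricTangentCone

variable {K : Type*} [Field K] {n : Fin 4 → ℕ}

theorem aeval_X_pow_monomial (m : Fin 4 →₀ ℕ) (c : K) :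
    aeval (fun i => (Polynomial.X : Polynomial K) ^ n i) (monomial m c) =
      Polynomial.monomial (Finsupp.weight n m) c := by
  rw [aeval_monomial, ← Polynomial.C_mul_X_pow_eq_monomial, Finsupp.weight_apply]
  congr 1
  rw [Finsupp.prod, Finsupp.sum, ← Finset.prod_pow_eq_pow_sum]
  refine Finset.prod_congr rfl fun i _ => ?_
  rw [← pow_mul, smul_eq_mul, mul_comm]

theorem homogeneousComponent_monomial_eq_ite (d : ℕ) (m : Fin 4 →₀ ℕ) (c : K) :
    homogeneousComponent d (monomial m c) = if m.degree = d then monomial m c else 0 := by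
  ext k
  rw [coeff_homogeneousComponent]
  by_cases h : m = k
  · subst h; split_ifs <;> simp
  · split_ifs <;> simp [coeff_monomial, h]

/-- The difference of two monomials of equal weight has its lower-degree part in `I_*`. -/
theorem monomial_sub_ite_mem_idealStar {a b : Fin 4 →₀ ℕ}
    (hw : Finsupp.weight n a = Finsupp.weight n b) (hd : a.degree ≤ b.degree) :
    (monomial a (1 : K) - if b.degree = a.degree then monomial b 1 else 0) ∈
      idealStar (toricIdeal K n) := by
  by_cases hab : a = b
  · subst hab; simp
  have hcomp : homogeneousComponent a.degree (monomial a (1 : K) - monomial b 1) =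
      monomial a (1 : K) - if b.degree = a.degree then monomial b 1 else 0 := by
    rw [map_sub, homogeneousComponent_monomial_eq_ite, homogeneousComponent_monomial_eq_ite,
      if_pos rfl]
  have hne : (monomial a (1 : K) - if b.degree = a.degree then monomial b 1 else 0) ≠ 0 := by
    intro h
    have h' := congrArg (coeff a) h
    split_ifs at h' <;> simp [coeff_monomial, Ne.symm hab] at h'
  refine Ideal.subset_span ⟨monomial a 1 - monomial b 1, ?_, ?_, a.degree, ?_, ?_, hcomp.symm⟩
  · rw [toricIdeal, RingHom.mem_ker, map_sub]
    erw [aeval_X_pow_monomial, aeval_X_pow_monomial]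
    rw [hw, sub_self]
  · intro h
    rw [h, map_zero] at hcomp
    exact hne hcomp.symm
  · intro e he
    rw [map_sub, homogeneousComponent_monomial_eq_ite, homogeneousComponent_monomial_eq_ite,
      if_neg (by omega), if_neg (by omega), sub_zero]
  · rwa [hcomp]

/-- The sum of the coefficients of the monomials of weight `s` and degree `d`. -/
noncomputable def bigradedCoeffSum (K : Type*) [Field K] (n : Fin 4 → ℕ) (s d : ℕ) :
    MvPolynomial (Fin 4) K →ₗ[K] K :=
  (basisMonomials (Fin 4) K).constr K
    fun m => if Finsupp.weight n m = s ∧ m.degree = d then 1 else 0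

theorem bigradedCoeffSum_monomial (s d : ℕ) (m : Fin 4 →₀ ℕ) (c : K) :
    bigradedCoeffSum K n s d (monomial m c) =
      if Finsupp.weight n m = s ∧ m.degree = d then c else 0 := by
  have h : monomial m c = c • basisMonomials (Fin 4) K m := by
    simp [smul_monomial]
  rw [h, map_smul, bigradedCoeffSum, Module.Basis.constr_basis]
  split_ifs <;> simp

theorem bigradedCoeffSum_monomial_mul_homogeneousComponent {s d e : ℕ}
    (hmax : ∀ m : Fin 4 →₀ ℕ, Finsupp.weight n m = s → m.degree ≤ d)
    {f : MvPolynomial (Fin 4) K} (hf : f ∈ toricIdeal K n)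
    (hlow : ∀ k < e, homogeneousComponent k f = 0) (a : Fin 4 →₀ ℕ) (c : K) :
    bigradedCoeffSum K n s d (monomial a c * homogeneousComponent e f) = 0 := by
  have hdeg : ∀ m ∈ f.support, e ≤ m.degree := by
    intro m hm
    by_contra! h
    have := congrArg (coeff m) (hlow _ h)
    rw [coeff_homogeneousComponent, if_pos rfl] at this
    exact (mem_support_iff.mp hm) this
  have hsum : bigradedCoeffSum K n s d (monomial a c * homogeneousComponent e f) =
      ∑ m ∈ f.support, if Finsupp.weight n (a + m) = s ∧ a.degree + e = d ∧ m.degree = e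
        then c * coeff m f else 0 := by
    conv_lhs => rw [f.as_sum]
    rw [map_sum, Finset.mul_sum, map_sum]
    refine Finset.sum_congr rfl fun m _ => ?_
    rw [homogeneousComponent_monomial_eq_ite]
    split_ifs with h1 h2 h2
    · rw [monomial_mul, bigradedCoeffSum_monomial, if_pos ⟨h2.1, by rw [map_add]; omega⟩]
    · rw [monomial_mul, bigradedCoeffSum_monomial, if_neg]
      rintro ⟨h3, h4⟩
      rw [map_add Finsupp.degree] at h4
      exact h2 ⟨h3, by omega, h1⟩
    · exact absurd h2.2.2 h1
    · simp
  rw [hsum]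
  by_cases hae : a.degree + e = d
  swap
  · exact Finset.sum_eq_zero fun m _ => if_neg fun h => hae h.2.1
  have hzero : (aeval (fun i => (Polynomial.X : Polynomial K) ^ n i)
      (monomial a c * f)).coeff s = 0 := by
    have : monomial a c * f ∈ toricIdeal K n := Ideal.mul_mem_left _ _ hf
    rw [toricIdeal, RingHom.mem_ker] at this
    erw [this]
    simp
  refine Eq.trans ?_ hzero
  conv_rhs => rw [f.as_sum]
  rw [Finset.mul_sum, map_sum, Polynomial.finsetSum_coeff]
  refine Finset.sum_congr rfl fun m hm => ?_
  rw [monomial_mul, aeval_X_pow_monomial, Polynomial.coeff_monomial]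
  refine if_congr ⟨fun h => h.1, fun h => ⟨h, hae, ?_⟩⟩ rfl rfl
  have h1 := hmax _ h
  rw [map_add] at h1
  have := hdeg m hm
  omega

/-- `bigradedCoeffSum` at a weight and the largest degree for it vanishes on `I_*`. -/
theorem bigradedCoeffSum_eq_zero_of_mem_idealStar {s d : ℕ}
    (hmax : ∀ m : Fin 4 →₀ ℕ, Finsupp.weight n m = s → m.degree ≤ d)
    {g : MvPolynomial (Fin 4) K} (hg : g ∈ idealStar (toricIdeal K n)) :
    bigradedCoeffSum K n s d g = 0 := by
  suffices h : ∀ r : MvPolynomial (Fin 4) K, bigradedCoeffSum K n s d (r * g) = 0 by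
    simpa using h 1
  induction hg using Submodule.span_induction with
  | mem x hx =>
    obtain ⟨f, hf, -, e, hlow, -, rfl⟩ := hx
    intro r
    rw [r.as_sum, Finset.sum_mul, map_sum]
    exact Finset.sum_eq_zero fun a _ =>
      bigradedCoeffSum_monomial_mul_homogeneousComponent hmax hf hlow a _
  | zero => simp
  | add x y _ _ hx hy => intro r; rw [mul_add, map_add, hx, hy, add_zero]
  | smul a x _ hx => intro r; rw [smul_eq_mul, ← mul_assoc]; exact hx _

/-- If `C` is a set of exponents of degree `i`, of pairwise distinct weights, representing
exactly the weights whose largest factorization length is `i`, then the Hilbert function of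
`K[x]/I_*` at `i` is the cardinality of `C`. -/
theorem hilbertFn_idealStar_toricIdeal (K : Type*) [Field K] (n : Fin 4 → ℕ) (i : ℕ)
    (C : Finset (Fin 4 →₀ ℕ)) (hdeg : ∀ a ∈ C, a.degree = i)
    (hinj : ∀ a ∈ C, ∀ b ∈ C, Finsupp.weight n a = Finsupp.weight n b → a = b)
    (hmax : ∀ a ∈ C, ∀ b, Finsupp.weight n b = Finsupp.weight n a → b.degree ≤ i)
    (hcov : ∀ a : Fin 4 →₀ ℕ, a.degree = i →
      (∃ b, Finsupp.weight n a = Finsupp.weight n b ∧ i < b.degree) ∨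
        ∃ b ∈ C, Finsupp.weight n a = Finsupp.weight n b) :
    hilbertFn K (idealStar (toricIdeal K n)) i = C.card := by
  set J := idealStar (toricIdeal K n) with hJ
  let v : C → MvPolynomial (Fin 4) K ⧸ J := fun a => Ideal.Quotient.mkₐ K J (monomial a.1 1)
  have hli : LinearIndependent K v := by
    rw [Fintype.linearIndependent_iff]
    intro c hc a
    have hmem : ∑ b, monomial b.1 (c b) ∈ J := by
      rw [← Ideal.Quotient.eq_zero_iff_mem, ← hc, map_sum]
      refine Finset.sum_congr rfl fun b _ => ?_
      have : monomial b.1 (c b) = c b • monomial b.1 (1 : K) := by simp [smul_monomial]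
      rw [this]
      exact map_smul (Ideal.Quotient.mkₐ K J) _ _
    have h0 := bigradedCoeffSum_eq_zero_of_mem_idealStar (hmax a.1 a.2) hmem
    rw [map_sum, Finset.sum_eq_single a] at h0
    · rwa [bigradedCoeffSum_monomial, if_pos ⟨rfl, hdeg a.1 a.2⟩] at h0
    · intro b _ hba
      rw [bigradedCoeffSum_monomial, if_neg]
      exact fun h => hba (Subtype.ext (hinj _ b.2 _ a.2 h.1))
    · simp
  have hspan : (homogeneousSubmodule (Fin 4) K i).map (Ideal.Quotient.mkₐ K J).toLinearMap =
      Submodule.span K (Set.range v) := by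
    apply le_antisymm
    · rw [Submodule.map_le_iff_le_comap]
      intro f hf
      rw [mem_homogeneousSubmodule] at hf
      rw [f.as_sum]
      refine Submodule.sum_mem _ fun a ha => ?_
      have hda : a.degree = i := by
        have := hf (mem_support_iff.mp ha)
        rwa [Finsupp.degree_eq_weight_one]
      have hsm : monomial a (coeff a f) = coeff a f • monomial a (1 : K) := by
        simp [smul_monomial]
      rw [hsm]
      refine Submodule.smul_mem _ _ ?_
      change Ideal.Quotient.mk J (monomial a 1) ∈ Submodule.span K (Set.range v)
      rcases hcov a hda with ⟨b, hw, hb⟩ | ⟨b, hb, hw⟩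
      · have h := monomial_sub_ite_mem_idealStar (K := K) hw (by omega)
        rw [if_neg (by omega), sub_zero] at h
        rw [Ideal.Quotient.eq_zero_iff_mem.mpr h]
        exact Submodule.zero_mem _
      · have hdb := hdeg b hb
        have h := monomial_sub_ite_mem_idealStar (K := K) hw (by omega)
        rw [if_pos (by omega)] at h
        rw [Ideal.Quotient.eq.mpr h]
        exact Submodule.subset_span ⟨⟨b, hb⟩, rfl⟩
    · rw [Submodule.span_le]
      rintro _ ⟨a, rfl⟩
      exact ⟨monomial a.1 1, isHomogeneous_monomial _ (hdeg a.1 a.2), rfl⟩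
  rw [hilbertFn, hspan, finrank_span_eq_card hli, Fintype.card_coe]

end ToricTangentCone

theorem finsupp_degree_fin_four (a : Fin 4 →₀ ℕ) : a.degree = a 0 + a 1 + a 2 + a 3 := by
  rw [Finsupp.degree_eq_sum, Fin.sum_univ_four]

/-- The weights `(2p, 5p, 3q, 2q)` with `p = 2N + 3` and `q = 2N + 5`. -/
def gluedWeights (N : ℕ) : Fin 4 → ℕ :=
  ![2 * (2 * N + 3), 5 * (2 * N + 3), 3 * (2 * N + 5), 2 * (2 * N + 5)]

theorem weight_gluedWeights (N : ℕ) (a : Fin 4 →₀ ℕ) :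
    Finsupp.weight (gluedWeights N) a =
      (2 * a 0 + 5 * a 1) * (2 * N + 3) + (3 * a 2 + 2 * a 3) * (2 * N + 5) := by
  rw [Finsupp.weight_apply, Finsupp.sum_fintype _ _ (by simp), Fin.sum_univ_four]
  simp [gluedWeights]
  ring

/-- Exponents of the monomials outside the initial ideal of `I(gluedWeights N)_*`. -/
def IsStandardExponent (N : ℕ) (a : Fin 4 →₀ ℕ) : Prop :=
  (a 1 = 0 ∧ a 2 = 0 ∧ a 3 ≤ 2 * N + 2) ∨ (a 1 = 0 ∧ a 2 = 1 ∧ a 3 < N) ∨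
    (a 1 = 1 ∧ a 2 = 0 ∧ a 3 ≤ N + 2) ∨ (a 1 = 1 ∧ a 2 = 1 ∧ a 0 < N ∧ a 3 < N)

theorem exists_shift_of_weight_eq {N : ℕ} {a b : Fin 4 →₀ ℕ}
    (h : Finsupp.weight (gluedWeights N) b = Finsupp.weight (gluedWeights N) a) :
    ∃ k : ℤ, (2 * b 0 + 5 * b 1 : ℤ) = 2 * a 0 + 5 * a 1 + k * (2 * N + 3) + 2 * k ∧
      (3 * b 2 + 2 * b 3 : ℤ) = 3 * a 2 + 2 * a 3 - k * (2 * N + 3) := by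
  rw [weight_gluedWeights, weight_gluedWeights] at h
  zify at h
  have hcop : IsCoprime (2 * N + 3 : ℤ) (2 * N + 5) := ⟨N + 2, -(N + 1), by ring⟩
  have hdvd : (2 * N + 3 : ℤ) ∣ (3 * a 2 + 2 * a 3 - (3 * b 2 + 2 * b 3)) := by
    refine hcop.dvd_of_dvd_mul_right ⟨2 * b 0 + 5 * b 1 - (2 * a 0 + 5 * a 1), ?_⟩
    linarith
  obtain ⟨k, hk⟩ := hdvd
  refine ⟨k, ?_, by linarith⟩
  have hne : (2 * N + 3 : ℤ) ≠ 0 := by positivity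
  apply mul_right_cancel₀ hne
  linear_combination h + (2 * N + 5 : ℤ) * hk

theorem IsStandardExponent.shift_le_one {N : ℕ} {a : Fin 4 →₀ ℕ} (ha : IsStandardExponent N a)
    {k v : ℤ} (hv : 0 ≤ v) (h : v = 3 * a 2 + 2 * a 3 - k * (2 * N + 3)) : k ≤ 1 := by
  by_contra! hk
  have : 2 * (2 * N + 3 : ℤ) ≤ k * (2 * N + 3) :=
    mul_le_mul_of_nonneg_right (by omega) (by positivity)
  unfold IsStandardExponent at ha
  omega

theorem IsStandardExponent.degree_le {N : ℕ} {a b : Fin 4 →₀ ℕ} (ha : IsStandardExponent N a)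
    (h : Finsupp.weight (gluedWeights N) b = Finsupp.weight (gluedWeights N) a) :
    b.degree ≤ a.degree := by
  obtain ⟨k, hu, hv⟩ := exists_shift_of_weight_eq h
  have hk := ha.shift_le_one (by positivity) hv
  rw [finsupp_degree_fin_four, finsupp_degree_fin_four]
  unfold IsStandardExponent at ha
  by_cases hk2 : k ≤ -2
  · generalize k * (2 * N + 3 : ℤ) = t at hu hv
    omega
  · obtain rfl | rfl | rfl : k = -1 ∨ k = 0 ∨ k = 1 := by omega
    all_goals omega

theorem IsStandardExponent.eq_of_weight_eq {N : ℕ} {a b : Fin 4 →₀ ℕ}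
    (ha : IsStandardExponent N a) (hb : IsStandardExponent N b) (hd : a.degree = b.degree)
    (h : Finsupp.weight (gluedWeights N) a = Finsupp.weight (gluedWeights N) b) : a = b := by
  obtain ⟨k, hu, hv⟩ := exists_shift_of_weight_eq h.symm
  have hk := ha.shift_le_one (by positivity) hv
  have hk' := hb.shift_le_one (k := -k) (v := 3 * a 2 + 2 * a 3) (by positivity) (by linarith)
  rw [finsupp_degree_fin_four, finsupp_degree_fin_four] at hd
  unfold IsStandardExponent at ha hb
  have : a 0 = b 0 ∧ a 1 = b 1 ∧ a 2 = b 2 ∧ a 3 = b 3 := by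
    obtain rfl | rfl | rfl : k = -1 ∨ k = 0 ∨ k = 1 := by omega
    all_goals omega
  ext j
  fin_cases j <;> simp [this]

/-- An exponent is standard, or has a longer one of the same weight, or has a standard one of
the same weight and degree. -/
theorem exists_longer_or_standard (N : ℕ) (a : Fin 4 →₀ ℕ) :
    (∃ b, Finsupp.weight (gluedWeights N) a = Finsupp.weight (gluedWeights N) b ∧
      a.degree < b.degree) ∨
    ∃ b, IsStandardExponent N b ∧ b.degree = a.degree ∧
      Finsupp.weight (gluedWeights N) a = Finsupp.weight (gluedWeights N) b := by
  suffices h : IsStandardExponent N a ∨ ∃ c : Fin 4 → ℕ,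
      (2 * a 0 + 5 * a 1) * (2 * N + 3) + (3 * a 2 + 2 * a 3) * (2 * N + 5) =
        (2 * c 0 + 5 * c 1) * (2 * N + 3) + (3 * c 2 + 2 * c 3) * (2 * N + 5) ∧
      (a 0 + a 1 + a 2 + a 3 < c 0 + c 1 + c 2 + c 3 ∨
        c 0 + c 1 + c 2 + c 3 = a 0 + a 1 + a 2 + a 3 ∧
          IsStandardExponent N (Finsupp.equivFunOnFinite.symm c)) by
    rcases h with h | ⟨c, hw, h | ⟨hd, h⟩⟩
    · exact Or.inr ⟨a, h, rfl, rfl⟩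
    · refine Or.inl ⟨Finsupp.equivFunOnFinite.symm c, ?_, ?_⟩
      · simpa only [weight_gluedWeights, Finsupp.coe_equivFunOnFinite_symm] using hw
      · simpa only [finsupp_degree_fin_four, Finsupp.coe_equivFunOnFinite_symm] using h
    · refine Or.inr ⟨Finsupp.equivFunOnFinite.symm c, h, ?_, ?_⟩
      · simpa only [finsupp_degree_fin_four, Finsupp.coe_equivFunOnFinite_symm] using hd
      · simpa only [weight_gluedWeights, Finsupp.coe_equivFunOnFinite_symm] using hw
  generalize ha0 : a 0 = x
  generalize ha1 : a 1 = y
  generalize ha2 : a 2 = z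
  generalize ha3 : a 3 = t
  by_cases h1 : 2 ≤ y
  · obtain ⟨y, rfl⟩ := Nat.exists_eq_add_of_le h1
    exact Or.inr ⟨![x + 5, y, z, t], by simp; ring, Or.inl (by simp; omega)⟩
  by_cases h2 : 2 ≤ z
  · obtain ⟨z, rfl⟩ := Nat.exists_eq_add_of_le h2
    exact Or.inr ⟨![x, y, z, t + 3], by simp; ring, Or.inl (by simp; omega)⟩
  by_cases h3 : 2 * N + 3 ≤ t
  · obtain ⟨t, rfl⟩ := Nat.exists_eq_add_of_le h3
    exact Or.inr ⟨![x + 2 * N + 5, y, z, t], by simp; ring, Or.inl (by simp; omega)⟩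
  obtain rfl | rfl : y = 0 ∨ y = 1 := by omega
  · obtain rfl | rfl : z = 0 ∨ z = 1 := by omega
    · exact Or.inl (Or.inl ⟨ha1, ha2, by omega⟩)
    · by_cases h4 : t < N
      · exact Or.inl (Or.inr (Or.inl ⟨ha1, ha2, by omega⟩))
      · obtain ⟨t, rfl⟩ := Nat.exists_eq_add_of_le (not_lt.mp h4)
        refine Or.inr ⟨![x + N, 1, 0, t], by simp; ring, Or.inr ⟨by simp; omega, ?_⟩⟩
        exact Or.inr (Or.inr (Or.inl ⟨rfl, rfl, by simp; omega⟩))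
  · obtain rfl | rfl : z = 0 ∨ z = 1 := by omega
    · by_cases h4 : t ≤ N + 2
      · exact Or.inl (Or.inr (Or.inr (Or.inl ⟨ha1, ha2, by omega⟩)))
      · obtain ⟨t, rfl⟩ := Nat.exists_eq_add_of_le (show N + 3 ≤ t by omega)
        exact Or.inr ⟨![x + N + 5, 0, 1, t], by simp; ring, Or.inl (by simp; omega)⟩
    · by_cases h4 : N ≤ x
      · obtain ⟨x, rfl⟩ := Nat.exists_eq_add_of_le h4
        exact Or.inr ⟨![x, 0, 0, t + N + 3], by simp; ring, Or.inl (by simp; omega)⟩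
      · by_cases h5 : N ≤ t
        · obtain ⟨t, rfl⟩ := Nat.exists_eq_add_of_le h5
          exact Or.inr ⟨![x + N + 5, 0, 0, t], by simp; ring, Or.inl (by simp; omega)⟩
        · exact Or.inl (Or.inr (Or.inr (Or.inr ⟨ha1, ha2, by omega, by omega⟩)))

open Classical in
/-- The standard exponents of degree `i`. -/
noncomputable def standardExponents (N i : ℕ) : Finset (Fin 4 →₀ ℕ) :=
  (Finset.finsuppAntidiag Finset.univ i).filter (IsStandardExponent N)

theorem mem_standardExponents {N i : ℕ} {a : Fin 4 →₀ ℕ} :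
    a ∈ standardExponents N i ↔ a 0 + a 1 + a 2 + a 3 = i ∧ IsStandardExponent N a := by
  simp [standardExponents, Fin.sum_univ_four]

theorem hilbertFn_gluedWeights (K : Type*) [Field K] (N i : ℕ) :
    hilbertFn K (idealStar (toricIdeal K (gluedWeights N))) i = (standardExponents N i).card := by
  have hdeg : ∀ a ∈ standardExponents N i, a.degree = i := fun a ha => by
    rw [finsupp_degree_fin_four, (mem_standardExponents.mp ha).1]
  refine hilbertFn_idealStar_toricIdeal K _ i _ hdeg ?_ ?_ ?_
  · intro a ha b hb
    exact (mem_standardExponents.mp ha).2.eq_of_weight_eq (mem_standardExponents.mp hb).2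
      (by rw [hdeg a ha, hdeg b hb])
  · intro a ha b h
    exact hdeg a ha ▸ (mem_standardExponents.mp ha).2.degree_le h
  · rintro a rfl
    refine (exists_longer_or_standard N a).imp_right ?_
    rintro ⟨b, hb, hd, hw⟩
    exact ⟨b, mem_standardExponents.mpr ⟨by rw [← finsupp_degree_fin_four, hd], hb⟩, hw⟩

theorem card_standardExponents_le_succ (N i : ℕ) :
    (standardExponents N i).card ≤ (standardExponents N (i + 1)).card := by
  refine Finset.card_le_card_of_injOn
    (fun a => if a 1 = 1 ∧ a 2 = 1 ∧ a 0 + 1 = N then Finsupp.single 3 (i + 1)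
      else a + Finsupp.single 0 1) ?_ ?_
  · intro a ha
    rw [Finset.mem_coe, mem_standardExponents] at ha ⊢
    unfold IsStandardExponent at ha ⊢
    beta_reduce
    split_ifs with h
    · simp
      omega
    · simp
      omega
  · intro a ha b hb hab
    rw [Finset.mem_coe, mem_standardExponents] at ha hb
    have key : ∀ j, _ := fun j => DFunLike.congr_fun hab j
    have h0 := key 0
    have h1 := key 1
    have h2 := key 2
    have h3 := key 3
    have : a 0 = b 0 ∧ a 1 = b 1 ∧ a 2 = b 2 ∧ a 3 = b 3 := by
      beta_reduce at h0 h1 h2 h3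
      split_ifs at h0 h1 h2 h3 <;> simp at h0 h1 h2 h3 <;> omega
    ext j
    fin_cases j <;> simp [this]

theorem stmt19 (K : Type*) [Field K] (m w : ℕ) (hm : 1 ≤ m)
    (n' : Fin 4 → ℕ)
    (hn' : n' = ![8 * m ^ 2 + 6 + 4 * w, 20 * m ^ 2 + 15 + 10 * w,
      12 * m ^ 2 + 15 + 6 * w, 8 * m ^ 2 + 10 + 4 * w])
    (hgcd : Nat.gcd (Nat.gcd (Nat.gcd (n' 0) (n' 1)) (n' 2)) (n' 3) = 1) :
    ∀ i : ℕ, hilbertFn K (idealStar (toricIdeal K n')) i ≤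
      hilbertFn K (idealStar (toricIdeal K n')) (i + 1) := by
  have hn : n' = gluedWeights (2 * m ^ 2 + w) := by
    rw [hn', gluedWeights]
    ext j
    fin_cases j <;> simp <;> ring
  intro i
  rw [hn, hilbertFn_gluedWeights, hilbertFn_gluedWeights]
  exact card_standardExponents_le_succ _ i
end
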